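/- Let G be a family of intervals in Z/nZ that is intersecting and butterfly-free, and such that every member has size at most n/2. Let M be the set of members G ∈ G for which there exist A, B ∈ G with A ⊊ G ⊊ B (middle intervals), and let I be the set of members of G comparable under inclusion with no other member of G (isolated intervals). Then Σ_{G ∈ G} 1/|G| ≤ 2 + Σ_{G ∈ M} 1/|G| − Σ_{G ∈ I} 1/|G|. -/

import Mathlib

/-- `Σ_I(n,k)` from the paper. -/
def SigmaI (n k : ℕ) : ℕ :=
  if n % 2 = 1 then
    ∑ i ∈ Finset.Icc ((n + 1) / 2) ((n + 1) / 2 + k - 1), Nat.choose n i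
  else
    Nat.choose (n - 1) (n / 2 - 1) +
      ∑ i ∈ Finset.Icc (n / 2 + 1) (n / 2 + k - 1), Nat.choose n i +
      Nat.choose (n - 1) (n / 2 + k)

/-- A family of finite sets is intersecting if any two members meet. -/
def Intersecting {α : Type*} [DecidableEq α] (F : Finset (Finset α)) : Prop :=
  ∀ A ∈ F, ∀ B ∈ F, (A ∩ B).Nonempty

/-- A family is butterfly-free if there are no four distinct members
`A,B,C,D` with `A ⊆ C`, `A ⊆ D`, `B ⊆ C`, `B ⊆ D`. -/
def ButterflyFree {α : Type*} (F : Finset (Finset α)) : Prop :=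
  ¬ ∃ A B C D : Finset α, A ∈ F ∧ B ∈ F ∧ C ∈ F ∧ D ∈ F ∧
    A ≠ B ∧ A ≠ C ∧ A ≠ D ∧ B ≠ C ∧ B ≠ D ∧ C ≠ D ∧
    A ⊆ C ∧ A ⊆ D ∧ B ⊆ C ∧ B ⊆ D

/-- A family is `k`-Sperner if it contains no chain of `k+1` distinct sets. -/
def KSperner {α : Type*} (k : ℕ) (F : Finset (Finset α)) : Prop :=
  ¬ ∃ c : Fin (k + 1) → Finset α, (∀ i, c i ∈ F) ∧ StrictMono c

/-- `S ⊆ ZMod n` is an interval if it is `{i, i+1, …, i+j-1}` for some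
`i : ZMod n` and `1 ≤ j ≤ n`. -/
def IsInterval (n : ℕ) (S : Finset (ZMod n)) : Prop :=
  ∃ (i : ZMod n) (j : ℕ), 1 ≤ j ∧ j ≤ n ∧
    S = (Finset.range j).image (fun t : ℕ => i + (t : ZMod n))

/-- The interval `A_i^j = {i, i+1, …, i+j-1}` in `ZMod n`. -/
def IntervalA (n : ℕ) (i : ZMod n) (j : ℕ) : Finset (ZMod n) :=
  (Finset.range j).image (fun t : ℕ => i + (t : ZMod n))

theorem mem_intervalA_add_iff {n : ℕ} (i : ZMod n) {d l t : ℕ} (hd : d < n) (hl : l ≤ n)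
    (ht : t < n) :
    i + (t : ZMod n) ∈ IntervalA n (i + d) l ↔ d ≤ t ∧ t < d + l ∨ t + n < d + l := by
  simp only [IntervalA, Finset.mem_image, Finset.mem_range]
  constructor
  · rintro ⟨u, hu, h⟩
    have h' : ((d + u : ℕ) : ZMod n) = t := by
      push_cast
      linear_combination h
    rw [ZMod.natCast_eq_natCast_iff'] at h'
    rw [Nat.mod_eq_of_lt ht] at h'
    rcases lt_or_ge (d + u) n with h1 | h1
    · rw [Nat.mod_eq_of_lt h1] at h'
      omega
    · rw [Nat.mod_eq_sub_mod h1, Nat.mod_eq_of_lt (by omega)] at h'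
      omega
  · rintro (⟨h1, h2⟩ | h)
    · refine ⟨t - d, by omega, ?_⟩
      rw [Nat.cast_sub h1]
      ring
    · refine ⟨t + n - d, by omega, ?_⟩
      rw [Nat.cast_sub (by omega), Nat.cast_add, ZMod.natCast_self]
      ring

theorem card_intervalA {n : ℕ} (i : ZMod n) {l : ℕ} (hl : l ≤ n) :
    (IntervalA n i l).card = l := by
  rw [IntervalA, Finset.card_image_of_injOn, Finset.card_range]
  intro a ha b hb h
  simp only [Finset.coe_range, Set.mem_Iio] at ha hb
  have h' := add_left_cancel h
  rw [ZMod.natCast_eq_natCast_iff', Nat.mod_eq_of_lt (by omega),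
    Nat.mod_eq_of_lt (by omega)] at h'
  exact h'

theorem exists_natCast_add_eq {n : ℕ} (hn : 0 < n) (i x : ZMod n) :
    ∃ t < n, i + (t : ZMod n) = x := by
  have : NeZero n := ⟨hn.ne'⟩
  exact ⟨(x - i).val, ZMod.val_lt _, by simp⟩

/-- The members of an interval, read off in coordinates based at `i`. -/
theorem IsInterval.exists_offset {n : ℕ} (hn : 0 < n) (i : ZMod n) {S : Finset (ZMod n)}
    (hS : IsInterval n S) :
    ∃ d < n, ∀ t < n, i + (t : ZMod n) ∈ S ↔ d ≤ t ∧ t < d + S.card ∨ t + n < d + S.card := by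
  obtain ⟨b, l, -, hl, rfl⟩ := hS
  obtain ⟨d, hd, rfl⟩ := exists_natCast_add_eq hn i b
  refine ⟨d, hd, fun t ht => ?_⟩
  have := card_intervalA (i + (d : ZMod n)) hl
  rw [IntervalA] at this
  rw [this]
  exact mem_intervalA_add_iff i hd hl ht

/-- An intersecting antichain of intervals of size at most `n / 2` has at most as many members
as its smallest member has elements. -/
theorem card_le_card_of_intersecting_antichain {n : ℕ} (hn : 0 < n)
    {F : Finset (Finset (ZMod n))} (hint : ∀ S ∈ F, IsInterval n S) (hmeet : Intersecting F)
    (hsize : ∀ S ∈ F, 2 * S.card ≤ n) (hanti : ∀ S ∈ F, ∀ T ∈ F, S ⊆ T → S = T)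
    {A : Finset (ZMod n)} (hA : A ∈ F) (hmin : ∀ S ∈ F, A.card ≤ S.card) :
    F.card ≤ A.card := by
  obtain ⟨i, k, hk, hkn, hAeq⟩ := hint A hA
  have hcard : A.card = k := hAeq ▸ card_intervalA i hkn
  have hmemA : ∀ t < n, i + (t : ZMod n) ∈ A ↔ t < k := by
    intro t ht
    have := mem_intervalA_add_iff i hn hkn ht
    rw [Nat.cast_zero, add_zero, IntervalA, ← hAeq] at this
    rw [this]
    omega
  have key : ∀ S ∈ F, ∃ d < n,
      ∀ t < n, i + (t : ZMod n) ∈ S ↔ d ≤ t ∧ t < d + S.card ∨ t + n < d + S.card :=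
    fun S hS => (hint S hS).exists_offset hn i
  choose! d hdn hd using key
  have hsub : ∀ S ∈ F, ∀ T ∈ F,
      (∀ t < n, i + (t : ZMod n) ∈ S → i + (t : ZMod n) ∈ T) → S = T := by
    intro S hS T hT h
    refine hanti S hS T hT fun x hx => ?_
    obtain ⟨t, ht, rfl⟩ := exists_natCast_add_eq hn i x
    exact h t ht hx
  have hinter : ∀ S ∈ F, ∀ T ∈ F, ∃ t < n, i + (t : ZMod n) ∈ S ∧ i + (t : ZMod n) ∈ T := by
    intro S hS T hT
    obtain ⟨x, hx⟩ := hmeet S hS T hT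
    obtain ⟨t, ht, rfl⟩ := exists_natCast_add_eq hn i x
    exact ⟨t, ht, Finset.mem_inter.1 hx⟩
  have hend : ∀ S ∈ F, d S < k ∨ n ≤ d S + S.card ∧ 0 < d S + S.card - n ∧
      d S + S.card - n < k := by
    intro S hS
    have h1 := hsize S hS
    have h2 := hsize A hA
    have h3 := hdn S hS
    obtain ⟨t, ht, htA, htS⟩ := hinter A hA S hS
    rw [hmemA t ht] at htA
    rw [hd S hS t ht] at htS
    by_contra hcon
    have hAS : A = S := by
      refine hsub A hA S hS fun u hu huA => ?_
      rw [hmemA u hu] at huA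
      rw [hd S hS u hu]
      omega
    subst hAS
    have := (hd A hS 0 hn).1 ((hmemA 0 hn).2 (by omega))
    omega
  have hstart0 : ∀ S ∈ F, d S = 0 → S = A := by
    intro S hS h0
    refine (hsub A hA S hS fun u hu huA => ?_).symm
    rw [hmemA u hu] at huA
    rw [hd S hS u hu]
    have := hmin S hS
    omega
  have hinj : Set.InjOn (fun S => if d S < k then d S else d S + S.card - n) F := by
    intro S hS T hT h
    simp only [Finset.mem_coe] at hS hT
    wlog hle : S.card ≤ T.card generalizing S T
    · exact (this h.symm hT hS (by omega)).symm
    have h1 := hsize S hS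
    have h2 := hsize T hT
    have h3 := hdn S hS
    have h4 := hdn T hT
    obtain ⟨t, ht, htS, htT⟩ := hinter S hS T hT
    rw [hd S hS t ht] at htS
    rw [hd T hT t ht] at htT
    have h5 := hend S hS
    have h6 := hend T hT
    refine hsub S hS T hT fun u hu huS => ?_
    rw [hd S hS u hu] at huS
    rw [hd T hT u hu]
    dsimp only at h
    split_ifs at h <;> omega
  calc F.card ≤ (Finset.range A.card).card := by
        refine Finset.card_le_card_of_injOn _ (fun S hS => ?_) hinj
        have := hend S hS
        simp only [Finset.coe_range, Set.mem_Iio]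
        split_ifs <;> omega
    _ = A.card := Finset.card_range _

theorem sum_one_div_card_le_one {n : ℕ} (hn : 0 < n)
    {F : Finset (Finset (ZMod n))} (hint : ∀ S ∈ F, IsInterval n S) (hmeet : Intersecting F)
    (hsize : ∀ S ∈ F, 2 * S.card ≤ n) (hanti : ∀ S ∈ F, ∀ T ∈ F, S ⊆ T → S = T) :
    ∑ S ∈ F, (1 : ℚ) / S.card ≤ 1 := by
  rcases F.eq_empty_or_nonempty with rfl | hne
  · simp
  obtain ⟨A, hA, hmin⟩ := Finset.exists_min_image F Finset.card hne
  have hle := card_le_card_of_intersecting_antichain hn hint hmeet hsize hanti hA hmin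
  have hpos : 0 < A.card := hne.card_pos.trans_le hle
  have hposQ : (0 : ℚ) < A.card := by exact_mod_cast hpos
  calc ∑ S ∈ F, (1 : ℚ) / S.card ≤ ∑ _S ∈ F, (1 : ℚ) / A.card :=
        Finset.sum_le_sum fun S hS =>
          one_div_le_one_div_of_le hposQ (by exact_mod_cast hmin S hS)
    _ = F.card / A.card := by rw [Finset.sum_const, nsmul_eq_mul, mul_one_div]
    _ ≤ 1 := (div_le_one hposQ).2 (by exact_mod_cast hle)

theorem butterflyFree_intervals_weight_ineq (n : ℕ) (hn : 0 < n)
    (G : Finset (Finset (ZMod n)))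
    (hint : ∀ S ∈ G, IsInterval n S)
    (hmeet : Intersecting G)
    (hB : ButterflyFree G)
    (hsize : ∀ S ∈ G, 2 * S.card ≤ n)
    (M I : Finset (Finset (ZMod n)))
    (hM : ∀ S : Finset (ZMod n),
      S ∈ M ↔ (S ∈ G ∧ ∃ A ∈ G, ∃ B ∈ G, A ⊂ S ∧ S ⊂ B))
    (hI : ∀ S : Finset (ZMod n),
      S ∈ I ↔ (S ∈ G ∧ ∀ T ∈ G, T ≠ S → ¬ S ⊆ T ∧ ¬ T ⊆ S)) :
    ∑ S ∈ G, (1 : ℚ) / S.card ≤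
      2 + ∑ S ∈ M, (1 : ℚ) / S.card - ∑ S ∈ I, (1 : ℚ) / S.card := by
  classical
  let P := G.filter fun S => ∀ T ∈ G, T ⊆ S → T = S
  let Q := G.filter fun S => ∀ T ∈ G, S ⊆ T → S = T
  have hP : ∑ S ∈ P, (1 : ℚ) / S.card ≤ 1 := by
    have hPG : ∀ S ∈ P, S ∈ G := fun S hS => (Finset.mem_filter.1 hS).1
    exact sum_one_div_card_le_one hn (fun S hS => hint S (hPG S hS))
      (fun S hS T hT => hmeet S (hPG S hS) T (hPG T hT)) (fun S hS => hsize S (hPG S hS))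
      fun S hS T hT => (Finset.mem_filter.1 hT).2 S (hPG S hS)
  have hQ : ∑ S ∈ Q, (1 : ℚ) / S.card ≤ 1 := by
    have hQG : ∀ S ∈ Q, S ∈ G := fun S hS => (Finset.mem_filter.1 hS).1
    exact sum_one_div_card_le_one hn (fun S hS => hint S (hQG S hS))
      (fun S hS T hT => hmeet S (hQG S hS) T (hQG T hT)) (fun S hS => hsize S (hQG S hS))
      fun S hS T hT => (Finset.mem_filter.1 hS).2 T (hQG T hT)
  have hinter : P ∩ Q = I := by
    ext S
    simp only [P, Q, Finset.mem_inter, Finset.mem_filter, hI]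
    grind
  have hunion : P ∪ Q = G \ M := by
    ext S
    simp only [P, Q, Finset.mem_union, Finset.mem_filter, Finset.mem_sdiff, hM,
      Finset.ssubset_iff_subset_ne]
    grind
  have hMG : M ⊆ G := fun S hS => ((hM S).1 hS).1
  have hsum := Finset.sum_union_inter (s₁ := P) (s₂ := Q) (f := fun S => (1 : ℚ) / S.card)
  rw [hunion, hinter] at hsum
  have hdiff := Finset.sum_sdiff (f := fun S => (1 : ℚ) / S.card) hMG
  linarith
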